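/- arXiv:2310.17981 — 6 statements merged into one kernel-verified Lean document; each statement's English description precedes it below -/
import Mathlib

section
/- Let T > 0 and let a, b be real numbers with a > −1, b > −1 and a + b + 1 > 0. Then K₁(ρ) := sup_{0≤s<t≤T} ∫_s^t e^{−ρ(t−r)} (r−s)^a (t−r)^b dr tends to 0 as ρ → ∞; equivalently, for every ε > 0 there exists ρ₀ ≥ 0 such that for all ρ ≥ ρ₀ and all 0 ≤ s < t ≤ T one has ∫_s^t e^{−ρ(t−r)} (r−s)^a (t−r)^b dr ≤ ε. -/
open MeasureTheory Set in
theorem intervalIntegrable_rpow_mul_one_sub_rpow {a c : ℝ} (ha : -1 < a) (hc : -1 < c) :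
    IntervalIntegrable (fun v : ℝ => v ^ a * (1 - v) ^ c) volume 0 1 := by
  have h := (Complex.betaIntegral_convergent (u := ((a + 1 : ℝ) : ℂ)) (v := ((c + 1 : ℝ) : ℂ))
    (by simp only [Complex.ofReal_re]; linarith) (by simp only [Complex.ofReal_re]; linarith)).norm
  rw [intervalIntegrable_iff_integrableOn_Ioo_of_le zero_le_one] at h ⊢
  refine h.congr_fun (fun v hv => ?_) measurableSet_Ioo
  have h0 : 0 < 1 - v := sub_pos.2 hv.2
  have h1 : (1 : ℂ) - v = ((1 - v : ℝ) : ℂ) := by push_cast; ring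
  simp only [norm_mul]
  rw [h1, Complex.norm_cpow_eq_rpow_re_of_pos hv.1, Complex.norm_cpow_eq_rpow_re_of_pos h0]
  simp

theorem Real.exp_neg_le_rpow_neg {x δ : ℝ} (hx : 0 < x) (hδ0 : 0 ≤ δ) (hδ1 : δ ≤ 1) :
    Real.exp (-x) ≤ x ^ (-δ) := by
  rw [Real.exp_neg, Real.rpow_neg hx.le]
  refine inv_anti₀ (Real.rpow_pos_of_pos hx δ) ?_
  calc x ^ δ ≤ (1 + x) ^ δ := Real.rpow_le_rpow hx.le (by linarith) hδ0
    _ ≤ (1 + x) ^ (1 : ℝ) := Real.rpow_le_rpow_of_exponent_le (by linarith) hδ1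
    _ ≤ Real.exp x := by rw [Real.rpow_one, add_comm]; exact Real.add_one_le_exp x

open MeasureTheory Set Filter in
theorem integral_exp_mul_rpow_mul_rpow_le {a b δ ρ s t : ℝ} (ha : -1 < a) (hb : -1 < b - δ)
    (hδ0 : 0 ≤ δ) (hδ1 : δ ≤ 1) (hρ : 0 < ρ) (hst : s < t) :
    (∫ r in s..t, Real.exp (-(ρ * (t - r))) * (r - s) ^ a * (t - r) ^ b) ≤
      ρ ^ (-δ) * ((t - s) ^ (a + b + 1 - δ) * ∫ v in (0 : ℝ)..1, v ^ a * (1 - v) ^ (b - δ)) := by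
  have hL : 0 < t - s := sub_pos.2 hst
  have hsub := intervalIntegral.mul_integral_comp_add_mul (a := 0) (b := 1)
    (f := fun r => Real.exp (-(ρ * (t - r))) * (r - s) ^ a * (t - r) ^ b) (t - s) s
  rw [mul_zero, add_zero, mul_one, add_sub_cancel] at hsub
  have hpow : (t - s) ^ (a + b + 1 - δ) = (t - s) * ((t - s) ^ a * (t - s) ^ (b - δ)) := by
    rw [← Real.rpow_add hL, mul_comm, ← Real.rpow_add_one hL.ne']
    congr 1; ring
  have hint := (intervalIntegrable_rpow_mul_one_sub_rpow ha hb).const_mul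
    (ρ ^ (-δ) * ((t - s) ^ a * (t - s) ^ (b - δ)))
  have hmain : (∫ v in (0 : ℝ)..1, Real.exp (-(ρ * (t - (s + (t - s) * v)))) *
      (s + (t - s) * v - s) ^ a * (t - (s + (t - s) * v)) ^ b) ≤
      ∫ v in (0 : ℝ)..1, ρ ^ (-δ) * ((t - s) ^ a * (t - s) ^ (b - δ)) *
        (v ^ a * (1 - v) ^ (b - δ)) := by
    rw [intervalIntegrable_iff_integrableOn_Ioo_of_le zero_le_one] at hint
    simp only [intervalIntegral.integral_of_le zero_le_one, integral_Ioc_eq_integral_Ioo]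
    refine integral_mono_of_nonneg ?_ hint ?_ <;>
    · refine (ae_restrict_iff' measurableSet_Ioo).2 (Eventually.of_forall fun v hv => ?_)
      have hv0 : 0 < v := hv.1
      have hv1 : 0 < 1 - v := sub_pos.2 hv.2
      have e1 : s + (t - s) * v - s = (t - s) * v := by ring
      have e2 : t - (s + (t - s) * v) = (t - s) * (1 - v) := by ring
      simp only [e1, e2, Pi.zero_apply]
      first
      | positivity
      | have hw : 0 < (t - s) * (1 - v) := mul_pos hL hv1
        calc _ ≤ (ρ * ((t - s) * (1 - v))) ^ (-δ) * ((t - s) * v) ^ a *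
              ((t - s) * (1 - v)) ^ b := by
              gcongr
              exact Real.exp_neg_le_rpow_neg (mul_pos hρ hw) hδ0 hδ1
          _ = ρ ^ (-δ) * ((t - s) * v) ^ a * ((t - s) * (1 - v)) ^ (b - δ) := by
              rw [Real.mul_rpow hρ.le hw.le, sub_eq_add_neg b δ, Real.rpow_add hw]
              ring
          _ = _ := by
              rw [Real.mul_rpow hL.le hv0.le, Real.mul_rpow hL.le hv1.le]
              ring
  calc _ ≤ _ := hsub.symm.le.trans (mul_le_mul_of_nonneg_left hmain hL.le)
    _ = _ := by rw [intervalIntegral.integral_const_mul, hpow]; ring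


/-- For `a, b > −1` with `a + b + 1 > 0`, the quantity
`K₁(ρ) = sup_{0≤s<t≤T} ∫_s^t e^{−ρ(t−r)} (r−s)^a (t−r)^b dr` tends to `0` as `ρ → ∞`:
for every `ε > 0` there is `ρ₀ ≥ 0` such that the integral is `≤ ε` uniformly in
`0 ≤ s < t ≤ T` whenever `ρ ≥ ρ₀`. -/
theorem K1_tendsto_zero
    (T a b : ℝ) (hT : 0 < T) (ha : -1 < a) (hb : -1 < b) (hab : 0 < a + b + 1) :
    ∀ ε > (0 : ℝ), ∃ ρ₀ : ℝ, 0 ≤ ρ₀ ∧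
      ∀ ρ ≥ ρ₀, ∀ s t : ℝ, 0 ≤ s → s < t → t ≤ T →
        (∫ r in s..t, Real.exp (-(ρ * (t - r))) * (r - s) ^ a * (t - r) ^ b) ≤ ε := by
  intro ε hε
  obtain ⟨δ, hδ0, hδ1, hδb, hδab⟩ :
      ∃ δ : ℝ, 0 < δ ∧ δ ≤ 1 ∧ -1 < b - δ ∧ δ ≤ a + b + 1 := by
    refine ⟨min 1 (min ((b + 1) / 2) (a + b + 1)), ?_, min_le_left _ _, ?_, ?_⟩
    · exact lt_min one_pos (lt_min (by linarith) hab)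
    · have := (min_le_right 1 (min ((b + 1) / 2) (a + b + 1))).trans (min_le_left _ _)
      linarith
    · exact (min_le_right _ _).trans (min_le_right _ _)
  set B : ℝ := ∫ v in (0 : ℝ)..1, v ^ a * (1 - v) ^ (b - δ) with hB
  have hB0 : 0 ≤ B := intervalIntegral.integral_nonneg zero_le_one fun v hv =>
    mul_nonneg (Real.rpow_nonneg hv.1 _) (Real.rpow_nonneg (sub_nonneg.2 hv.2) _)
  have hlim : Filter.Tendsto (fun ρ : ℝ => ρ ^ (-δ) * (T ^ (a + b + 1 - δ) * B))
      Filter.atTop (nhds 0) := by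
    simpa using (tendsto_rpow_neg_atTop hδ0).mul_const (T ^ (a + b + 1 - δ) * B)
  obtain ⟨M, hM⟩ := Filter.eventually_atTop.1 (hlim.eventually_le_const hε)
  refine ⟨max M 1, zero_le_one.trans (le_max_right _ _), fun ρ hρ s t hs hst htT => ?_⟩
  have hρ0 : 0 < ρ := one_pos.trans_le ((le_max_right _ _).trans hρ)
  refine (integral_exp_mul_rpow_mul_rpow_le ha hδb hδ0.le hδ1 hρ0 hst).trans
    (le_trans ?_ (hM ρ ((le_max_left _ _).trans hρ)))
  have hpow : (t - s) ^ (a + b + 1 - δ) ≤ T ^ (a + b + 1 - δ) :=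
    Real.rpow_le_rpow (sub_nonneg.2 hst.le) (by linarith) (by linarith)
  exact mul_le_mul_of_nonneg_left (mul_le_mul_of_nonneg_right hpow hB0)
    (Real.rpow_nonneg hρ0.le _)
end

section
/- Assume in addition that for all τ, τ' > 0 and all v ∈ V: ‖Φ_τ v‖ ≤ c_S ‖v‖, ‖π(Φ_τ v)‖ ≤ c_S ‖π v‖, and ‖π(Φ_τ v − Φ_{τ'} v)‖ ≤ c_S |τ − τ'|^β ‖v‖. Then there exists a constant C, depending only on α and β, such that for all 0 ≤ s < r < t ≤ T, ‖π( D_{s+}^α [τ ↦ Φ_{t−τ}(G(u(τ)))] [r] )‖ ≤ C · c_S · L_G · ‖u‖_{β,ρ,−β} · ( (r−s)^{−α} + (r−s)^{β−α} ) · e^{ρ r}. -/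
/-- Left-sided Weyl fractional derivative of order `α` with base point `s₀`:
`D_{s₀+}^α Z[r] = (1/Γ(1−α)) ( Z(r)/(r−s₀)^α + α ∫_{s₀}^r (Z(r) − Z(q))/(r−q)^{1+α} dq )`. -/
noncomputable def weylD {V : Type*} [NormedAddCommGroup V] [NormedSpace ℝ V]
    (α s₀ : ℝ) (Z : ℝ → V) (r : ℝ) : V :=
  (Real.Gamma (1 - α))⁻¹ •
    ((((r - s₀) ^ α)⁻¹) • Z r +
      α • ∫ q in s₀..r, (((r - q) ^ (1 + α))⁻¹) • (Z r - Z q))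

/-- The weighted Hölder norm
`‖u‖_{β,ρ,−β} = sup_{t∈[0,T]} e^{−ρ t} ‖u(t)‖
  + sup_{0≤s<t≤T} e^{−ρ t} ‖ι(u(t)) − ι(u(s))‖ / (t−s)^β`. -/
noncomputable def hNorm {E F : Type*} [NormedAddCommGroup E] [NormedSpace ℝ E]
    [NormedAddCommGroup F] [NormedSpace ℝ F]
    (ι : E →L[ℝ] F) (β ρ T : ℝ) (u : ℝ → E) : ℝ :=
  sSup ((fun t => Real.exp (-(ρ * t)) * ‖u t‖) '' Set.Icc 0 T) +
    sSup ((fun p : ℝ × ℝ =>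
        Real.exp (-(ρ * p.2)) * ‖ι (u p.2) - ι (u p.1)‖ / (p.2 - p.1) ^ β) ''
      {p : ℝ × ℝ | 0 ≤ p.1 ∧ p.1 < p.2 ∧ p.2 ≤ T})

/-- Finiteness of the weighted Hölder norm `‖u‖_{β,ρ,−β}`. -/
def hFin {E F : Type*} [NormedAddCommGroup E] [NormedSpace ℝ E]
    [NormedAddCommGroup F] [NormedSpace ℝ F]
    (ι : E →L[ℝ] F) (β ρ T : ℝ) (u : ℝ → E) : Prop :=
  BddAbove ((fun t => Real.exp (-(ρ * t)) * ‖u t‖) '' Set.Icc 0 T) ∧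
    BddAbove ((fun p : ℝ × ℝ =>
        Real.exp (-(ρ * p.2)) * ‖ι (u p.2) - ι (u p.1)‖ / (p.2 - p.1) ^ β) ''
      {p : ℝ × ℝ | 0 ≤ p.1 ∧ p.1 < p.2 ∧ p.2 ≤ T})

open MeasureTheory intervalIntegral in
/-- If `Z` is bounded at `r` and `β`-Hölder at `r` after applying `prj`, with constant `K`, then the
projected Weyl derivative of order `α < β` is bounded accordingly. No integrability is needed: a
non-integrable integrand only contributes `0`. -/
theorem norm_map_weylD_le {V W : Type*}
    [NormedAddCommGroup V] [NormedSpace ℝ V] [CompleteSpace V]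
    [NormedAddCommGroup W] [NormedSpace ℝ W] [CompleteSpace W]
    (prj : V →L[ℝ] W) {α β s r K : ℝ} (h0α : 0 < α) (hαβ : α < β) (hα1 : α < 1)
    (hsr : s < r) (Z : ℝ → V) (hZr : ‖prj (Z r)‖ ≤ K)
    (hZ : ∀ q, s < q → q < r → ‖prj (Z r - Z q)‖ ≤ K * (r - q) ^ β) :
    ‖prj (weylD α s Z r)‖ ≤ (Real.Gamma (1 - α))⁻¹ *
      (K * (r - s) ^ (-α) + α * (K * ((r - s) ^ (β - α) / (β - α)))) := by
  have hΓ : 0 < Real.Gamma (1 - α) := Real.Gamma_pos_of_pos (by linarith)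
  have hK : 0 ≤ K := (norm_nonneg _).trans hZr
  have hrs : 0 < r - s := sub_pos.2 hsr
  have hint : ‖prj (∫ q in s..r, (((r - q) ^ (1 + α))⁻¹) • (Z r - Z q))‖
      ≤ K * ((r - s) ^ (β - α) / (β - α)) := by
    by_cases hI : IntervalIntegrable
        (fun q => (((r - q) ^ (1 + α))⁻¹) • (Z r - Z q)) volume s r
    · rw [← ContinuousLinearMap.intervalIntegral_comp_comm prj hI]
      have hval : ∫ q in s..r, K * (r - q) ^ (β - α - 1) =
          K * ((r - s) ^ (β - α) / (β - α)) := by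
        rw [intervalIntegral.integral_const_mul,
          intervalIntegral.integral_comp_sub_left (fun x => x ^ (β - α - 1)) r, sub_self,
          integral_rpow (Or.inl (by linarith)), sub_add_cancel,
          Real.zero_rpow (by linarith), sub_zero]
      have hbd : IntervalIntegrable (fun q => K * (r - q) ^ (β - α - 1)) volume s r := by
        have h := (intervalIntegrable_rpow' (a := r - s) (b := r - r)
          (r := β - α - 1) (by linarith)).comp_sub_left r
        simpa using h.const_mul K
      rw [← hval]
      refine norm_integral_le_of_norm_le hsr.le ?_ hbd
      filter_upwards [compl_mem_ae_iff.2 (measure_singleton (μ := volume) r)] with q hq hqs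
      have hqr : q < r := lt_of_le_of_ne hqs.2 hq
      have hpos : 0 < r - q := sub_pos.2 hqr
      rw [map_smul, norm_smul, norm_inv, Real.norm_of_nonneg (Real.rpow_nonneg hpos.le _)]
      calc ((r - q) ^ (1 + α))⁻¹ * ‖prj (Z r - Z q)‖
          ≤ ((r - q) ^ (1 + α))⁻¹ * (K * (r - q) ^ β) := by
            gcongr; exact hZ q hqs.1 hqr
        _ = K * (r - q) ^ (β - α - 1) := by
            rw [show β - α - 1 = -(1 + α) + β by ring, Real.rpow_add hpos (-(1 + α)),
              Real.rpow_neg hpos.le]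
            ring
    · rw [integral_undef hI, map_zero, norm_zero]
      have : 0 < β - α := sub_pos.2 hαβ
      positivity
  rw [weylD, map_smul, norm_smul, norm_inv, Real.norm_of_nonneg hΓ.le, map_add, map_smul,
    map_smul]
  gcongr
  refine (norm_add_le _ _).trans (add_le_add ?_ ?_)
  · rw [norm_smul, ← Real.rpow_neg hrs.le, Real.norm_of_nonneg (Real.rpow_nonneg hrs.le _),
      mul_comm]
    gcongr
  · rw [norm_smul, Real.norm_of_nonneg h0α.le]
    gcongr

section hNorm

variable {E F : Type*} [NormedAddCommGroup E] [NormedSpace ℝ E]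
  [NormedAddCommGroup F] [NormedSpace ℝ F]
  {ι : E →L[ℝ] F} {β ρ T : ℝ} {u : ℝ → E}

/-- The pointwise bound and the increment bound contained in `hNorm`, added together. -/
theorem hFin.norm_add_norm_sub_le (hu : hFin ι β ρ T u) {q r : ℝ}
    (hq : 0 ≤ q) (hqr : q < r) (hrT : r ≤ T) :
    ‖u r‖ * (r - q) ^ β + ‖ι (u r) - ι (u q)‖ ≤
      hNorm ι β ρ T u * Real.exp (ρ * r) * (r - q) ^ β := by
  have h1 := le_csSup hu.1 ⟨r, ⟨hq.trans hqr.le, hrT⟩, rfl⟩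
  have h2 := le_csSup hu.2 ⟨(q, r), ⟨hq, hqr, hrT⟩, rfl⟩
  have hpos : 0 < (r - q) ^ β := Real.rpow_pos_of_pos (sub_pos.2 hqr) _
  have h := add_le_add h1 h2
  change _ ≤ hNorm ι β ρ T u at h
  simp only [Real.exp_neg] at h
  have he := Real.exp_pos (ρ * r)
  calc _ = ((Real.exp (ρ * r))⁻¹ * ‖u r‖ +
        (Real.exp (ρ * r))⁻¹ * ‖ι (u r) - ι (u q)‖ / (r - q) ^ β) *
          Real.exp (ρ * r) * (r - q) ^ β := by field_simp
    _ ≤ _ := by gcongr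

/-- The pointwise bound contained in `hNorm`. -/
theorem hFin.norm_le (hu : hFin ι β ρ T u) {r : ℝ} (hr : 0 < r) (hrT : r ≤ T) :
    ‖u r‖ ≤ hNorm ι β ρ T u * Real.exp (ρ * r) := by
  have hpos : 0 < (r - 0) ^ β := Real.rpow_pos_of_pos (by simpa using hr) _
  have h := hu.norm_add_norm_sub_le le_rfl hr hrT
  exact le_of_mul_le_mul_right ((le_add_of_nonneg_right (norm_nonneg _)).trans h) hpos

end hNorm

/-- Estimate of `‖π(D_{s+}^α [τ ↦ S(t−τ)G(u(τ))][r])‖` in the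
`𝓑_{−β}`-type norm: there is a constant `C = C(α,β)` with
`‖π(D_{s+}^α [Φ_{t−·}(G∘u)][r])‖ ≤ C c_S L_G ‖u‖_{β,ρ,−β} ((r−s)^{−α} + (r−s)^{β−α}) e^{ρ r}`. -/
theorem weylD_semigroup_G_bound_minusBeta
    {E F V W : Type*}
    [NormedAddCommGroup E] [NormedSpace ℝ E] [CompleteSpace E]
    [NormedAddCommGroup F] [NormedSpace ℝ F] [CompleteSpace F]
    [NormedAddCommGroup V] [NormedSpace ℝ V] [CompleteSpace V]
    [NormedAddCommGroup W] [NormedSpace ℝ W] [CompleteSpace W]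
    (ι : E →L[ℝ] F) (prj : V →L[ℝ] W)
    (hι : ∀ x : E, ‖ι x‖ ≤ ‖x‖) (hprj : ∀ v : V, ‖prj v‖ ≤ ‖v‖)
    (α β : ℝ) (h0α : 0 < α) (hαβ : α < β) (hβ1 : β < 1) :
    ∃ C : ℝ, 0 < C ∧
      ∀ (cS L_G ρ T : ℝ) (Φ : ℝ → V →L[ℝ] V) (G : E → V) (u : ℝ → E),
        1 ≤ cS → 0 ≤ L_G → 0 ≤ ρ → 0 < T →
        (∀ v : V, ContinuousOn (fun τ => Φ τ v) (Set.Ioi 0)) →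
        (∀ τ : ℝ, 0 < τ → ∀ v : V, ‖Φ τ v‖ ≤ cS * ‖v‖) →
        (∀ τ : ℝ, 0 < τ → ∀ v : V, ‖prj (Φ τ v)‖ ≤ cS * ‖prj v‖) →
        (∀ τ τ' : ℝ, 0 < τ → 0 < τ' → ∀ v : V,
          ‖prj (Φ τ v - Φ τ' v)‖ ≤ cS * |τ - τ'| ^ β * ‖v‖) →
        G 0 = 0 →
        (∀ x y : E, ‖G x - G y‖ ≤ L_G * ‖x - y‖) →
        (∀ x y : E, ‖prj (G x - G y)‖ ≤ L_G * ‖ι x - ι y‖) →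
        ContinuousOn u (Set.Icc 0 T) →
        hFin ι β ρ T u →
        ∀ s r t : ℝ, 0 ≤ s → s < r → r < t → t ≤ T →
          ‖prj (weylD α s (fun τ => Φ (t - τ) (G (u τ))) r)‖ ≤
            C * cS * L_G * hNorm ι β ρ T u *
              ((r - s) ^ (-α) + (r - s) ^ (β - α)) * Real.exp (ρ * r) := by
  have hα1 : α < 1 := hαβ.trans hβ1
  have hΓ : 0 < Real.Gamma (1 - α) := Real.Gamma_pos_of_pos (by linarith)
  have hd : 0 < β - α := sub_pos.2 hαβ
  refine ⟨(Real.Gamma (1 - α))⁻¹ * (1 + α / (β - α)), by positivity, ?_⟩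
  intro cS L_G ρ T Φ G u hcS hL _ _ _ hΦ hΦprj hΦh hG0 hG hGprj _ hu s r t hs hsr hrt htT
  have hcS0 : 0 ≤ cS := zero_le_one.trans hcS
  have hrT : r ≤ T := hrt.le.trans htT
  have hGle : ∀ x, ‖G x‖ ≤ L_G * ‖x‖ := fun x => by simpa [hG0] using hG x 0
  have hur := hu.norm_le (hs.trans_lt hsr) hrT
  set N := hNorm ι β ρ T u
  set K := cS * (L_G * (N * Real.exp (ρ * r))) with hKdef
  have hN : 0 ≤ N * Real.exp (ρ * r) := (norm_nonneg _).trans hur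
  have hZr : ‖prj (Φ (t - r) (G (u r)))‖ ≤ K := by
    refine (hprj _).trans ((hΦ _ (sub_pos.2 hrt) _).trans ?_)
    refine mul_le_mul_of_nonneg_left ((hGle _).trans ?_) hcS0
    gcongr
  have hZ : ∀ q, s < q → q < r →
      ‖prj (Φ (t - r) (G (u r)) - Φ (t - q) (G (u q)))‖ ≤ K * (r - q) ^ β := by
    intro q hsq hqr
    have hsplit : Φ (t - r) (G (u r)) - Φ (t - q) (G (u q)) =
        (Φ (t - r) (G (u r)) - Φ (t - q) (G (u r))) + Φ (t - q) (G (u r) - G (u q)) := by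
      rw [map_sub]; abel
    have hpow : 0 ≤ (r - q) ^ β := Real.rpow_nonneg (sub_pos.2 hqr).le _
    have h1 := hΦh (t - r) (t - q) (by linarith) (by linarith) (G (u r))
    rw [show t - r - (t - q) = -(r - q) by ring, abs_neg, abs_of_pos (sub_pos.2 hqr)] at h1
    have h2 := hΦprj (t - q) (by linarith) (G (u r) - G (u q))
    rw [hsplit, map_add]
    calc _ ≤ cS * (r - q) ^ β * ‖G (u r)‖ + cS * ‖prj (G (u r) - G (u q))‖ :=
          (norm_add_le _ _).trans (add_le_add h1 h2)
      _ ≤ cS * (r - q) ^ β * (L_G * ‖u r‖) + cS * (L_G * ‖ι (u r) - ι (u q)‖) := by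
          gcongr
          · exact hGle _
          · exact hGprj _ _
      _ = cS * (L_G * (‖u r‖ * (r - q) ^ β + ‖ι (u r) - ι (u q)‖)) := by ring
      _ ≤ cS * (L_G * (N * Real.exp (ρ * r) * (r - q) ^ β)) := by
          gcongr
          exact hu.norm_add_norm_sub_le (hs.trans hsq.le) hqr hrT
      _ = K * (r - q) ^ β := by rw [hKdef]; ring
  have hK : 0 ≤ K := by positivity
  have hrs : 0 < r - s := sub_pos.2 hsr
  calc _ ≤ (Real.Gamma (1 - α))⁻¹ *
        (K * (r - s) ^ (-α) + α * (K * ((r - s) ^ (β - α) / (β - α)))) :=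
        norm_map_weylD_le prj h0α hαβ hα1 hsr _ hZr hZ
    _ = (Real.Gamma (1 - α))⁻¹ *
        (K * (1 * (r - s) ^ (-α) + α / (β - α) * (r - s) ^ (β - α))) := by ring
    _ ≤ (Real.Gamma (1 - α))⁻¹ *
        (K * ((1 + α / (β - α)) * (r - s) ^ (-α) +
          (1 + α / (β - α)) * (r - s) ^ (β - α))) := by
        have : 0 ≤ α / (β - α) := by positivity
        gcongr <;> linarith
    _ = _ := by rw [hKdef]; ring
end

section
/- Assume in addition that for all v ∈ V: ‖Φ_τ v‖ ≤ c_S ‖v‖ for all τ > 0, ‖Φ_a v − Φ_b v‖ ≤ c_S (b−a)^β a^{−β} ‖v‖ for all 0 < a < b, and ‖Φ_τ v‖ ≤ c_S τ^{−β} ‖π v‖ for all τ > 0. Then there exists a constant C, depending only on α and β, such that for all 0 ≤ s < r < t ≤ T, ‖ D_{s+}^α [τ ↦ Φ_{t−τ}(G(u(τ)))] [r] ‖ ≤ C · c_S · L_G · ‖u‖_{β,ρ,−β} · ( (r−s)^{−α} + (t−r)^{−β} (r−s)^{β−α} ) · e^{ρ r}. -/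
/-- The Weyl derivative of `Z` at `r` is controlled by a bound on `Z r` and a Hölder bound
`‖Z r - Z q‖ ≤ B (r - q) ^ β` at `r`, when `α < β`. -/
theorem norm_weylD_le_of_holder {V : Type*} [NormedAddCommGroup V] [NormedSpace ℝ V]
    {α β s r A B : ℝ} {Z : ℝ → V} (h0α : 0 < α) (hαβ : α < β) (hα1 : α < 1) (hsr : s < r)
    (hA : ‖Z r‖ ≤ A) (hB : ∀ q, s < q → q < r → ‖Z r - Z q‖ ≤ B * (r - q) ^ β) :
    ‖weylD α s Z r‖ ≤
      (Real.Gamma (1 - α))⁻¹ *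
        (A * (r - s) ^ (-α) + α / (β - α) * (B * (r - s) ^ (β - α))) := by
  have hΓ : 0 < Real.Gamma (1 - α) := Real.Gamma_pos_of_pos (by linarith)
  have hp : -1 < β - 1 - α := by linarith
  have hint : IntervalIntegrable (fun q : ℝ => B * (r - q) ^ (β - 1 - α))
      MeasureTheory.volume s r := by
    have h := (intervalIntegral.intervalIntegrable_rpow' (a := r - s) (b := 0) hp).comp_sub_left r
    simp only [sub_sub_cancel, sub_zero] at h
    exact h.const_mul B
  have hval : ∫ q in s..r, B * (r - q) ^ (β - 1 - α) = B * (r - s) ^ (β - α) / (β - α) := by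
    rw [intervalIntegral.integral_const_mul,
      intervalIntegral.integral_comp_sub_left (fun x : ℝ => x ^ (β - 1 - α)) r,
      integral_rpow (Or.inl hp), sub_self, show β - 1 - α + 1 = β - α by ring,
      Real.zero_rpow (by linarith), sub_zero, mul_div_assoc]
  have hI : ‖∫ q in s..r, (((r - q) ^ (1 + α))⁻¹) • (Z r - Z q)‖ ≤
      B * (r - s) ^ (β - α) / (β - α) := by
    rw [← hval]
    refine intervalIntegral.norm_integral_le_of_norm_le hsr.le ?_ hint
    filter_upwards [MeasureTheory.Measure.ae_ne MeasureTheory.volume r] with q hne hq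
    have hqr : q < r := lt_of_le_of_ne hq.2 hne
    have hpos : 0 < r - q := sub_pos.2 hqr
    rw [norm_smul, Real.norm_of_nonneg (by positivity), ← Real.rpow_neg hpos.le]
    calc (r - q) ^ (-(1 + α)) * ‖Z r - Z q‖
        ≤ (r - q) ^ (-(1 + α)) * (B * (r - q) ^ β) := by
          gcongr
          exact hB q hq.1 hqr
      _ = B * (r - q) ^ (β - 1 - α) := by
          rw [mul_left_comm, ← Real.rpow_add hpos]
          ring_nf
  have hrs : 0 < r - s := sub_pos.2 hsr
  rw [weylD, norm_smul, Real.norm_of_nonneg (by positivity)]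
  gcongr
  refine (norm_add_le _ _).trans (add_le_add ?_ ?_)
  · rw [norm_smul, Real.norm_of_nonneg (by positivity), ← Real.rpow_neg hrs.le, mul_comm]
    gcongr
  · rw [norm_smul, Real.norm_of_nonneg h0α.le]
    calc _ ≤ α * (B * (r - s) ^ (β - α) / (β - α)) := by gcongr
      _ = _ := by ring

/-- A function of finite weighted Hölder norm obeys the corresponding pointwise bounds: the norm
splits as `N₁ + N₂` with `N₁` bounding the values and `N₂` the increments. -/
theorem hFin.exists_bounds {E F : Type*} [NormedAddCommGroup E] [NormedSpace ℝ E]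
    [NormedAddCommGroup F] [NormedSpace ℝ F] {ι : E →L[ℝ] F} {β ρ T : ℝ} {u : ℝ → E}
    (h : hFin ι β ρ T u) :
    ∃ N₁ N₂ : ℝ, 0 ≤ N₁ ∧ 0 ≤ N₂ ∧ hNorm ι β ρ T u = N₁ + N₂ ∧
      (∀ t, 0 ≤ t → t ≤ T → ‖u t‖ ≤ N₁ * Real.exp (ρ * t)) ∧
      ∀ q r, 0 ≤ q → q < r → r ≤ T →
        ‖ι (u r) - ι (u q)‖ ≤ N₂ * (r - q) ^ β * Real.exp (ρ * r) := by
  refine ⟨_, _, Real.sSup_nonneg ?_, Real.sSup_nonneg ?_, rfl, fun t h0 hT => ?_,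
    fun q r h0 hqr hT => ?_⟩
  · rintro _ ⟨t, -, rfl⟩
    positivity
  · rintro _ ⟨p, hp, rfl⟩
    have : 0 < p.2 - p.1 := sub_pos.2 hp.2.1
    positivity
  · have := le_csSup h.1 ⟨t, ⟨h0, hT⟩, rfl⟩
    beta_reduce at this
    rwa [Real.exp_neg, inv_mul_le_iff₀ (Real.exp_pos _), mul_comm] at this
  · have := le_csSup h.2 ⟨(q, r), ⟨h0, hqr, hT⟩, rfl⟩
    have hpos : 0 < r - q := sub_pos.2 hqr
    beta_reduce at this
    rwa [div_le_iff₀ (by positivity), Real.exp_neg, inv_mul_le_iff₀ (Real.exp_pos _), mul_comm] at this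

/-- Estimate of `‖D_{s+}^α [τ ↦ S(t−τ)G(u(τ))][r]‖` in the state-space
norm: there is a constant `C = C(α,β)` with
`‖D_{s+}^α [Φ_{t−·}(G∘u)][r]‖ ≤ C c_S L_G ‖u‖_{β,ρ,−β} ((r−s)^{−α} + (t−r)^{−β}(r−s)^{β−α}) e^{ρ r}`. -/
theorem weylD_semigroup_G_bound_state
    {E F V W : Type*}
    [NormedAddCommGroup E] [NormedSpace ℝ E] [CompleteSpace E]
    [NormedAddCommGroup F] [NormedSpace ℝ F] [CompleteSpace F]
    [NormedAddCommGroup V] [NormedSpace ℝ V] [CompleteSpace V]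
    [NormedAddCommGroup W] [NormedSpace ℝ W] [CompleteSpace W]
    (ι : E →L[ℝ] F) (prj : V →L[ℝ] W)
    (hι : ∀ x : E, ‖ι x‖ ≤ ‖x‖) (hprj : ∀ v : V, ‖prj v‖ ≤ ‖v‖)
    (α β : ℝ) (h0α : 0 < α) (hαβ : α < β) (hβ1 : β < 1) :
    ∃ C : ℝ, 0 < C ∧
      ∀ (cS L_G ρ T : ℝ) (Φ : ℝ → V →L[ℝ] V) (G : E → V) (u : ℝ → E),
        1 ≤ cS → 0 ≤ L_G → 0 ≤ ρ → 0 < T →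
        (∀ v : V, ContinuousOn (fun τ => Φ τ v) (Set.Ioi 0)) →
        (∀ τ : ℝ, 0 < τ → ∀ v : V, ‖Φ τ v‖ ≤ cS * ‖v‖) →
        (∀ a b : ℝ, 0 < a → a < b → ∀ v : V,
          ‖Φ a v - Φ b v‖ ≤ cS * (b - a) ^ β * a ^ (-β) * ‖v‖) →
        (∀ τ : ℝ, 0 < τ → ∀ v : V, ‖Φ τ v‖ ≤ cS * τ ^ (-β) * ‖prj v‖) →
        G 0 = 0 →
        (∀ x y : E, ‖G x - G y‖ ≤ L_G * ‖x - y‖) →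
        (∀ x y : E, ‖prj (G x - G y)‖ ≤ L_G * ‖ι x - ι y‖) →
        ContinuousOn u (Set.Icc 0 T) →
        hFin ι β ρ T u →
        ∀ s r t : ℝ, 0 ≤ s → s < r → r < t → t ≤ T →
          ‖weylD α s (fun τ => Φ (t - τ) (G (u τ))) r‖ ≤
            C * cS * L_G * hNorm ι β ρ T u *
              ((r - s) ^ (-α) + (t - r) ^ (-β) * (r - s) ^ (β - α)) * Real.exp (ρ * r) := by
  have hΓ : 0 < Real.Gamma (1 - α) := Real.Gamma_pos_of_pos (by linarith)
  have hκ : 0 < α / (β - α) := div_pos h0α (sub_pos.2 hαβ)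
  refine ⟨(Real.Gamma (1 - α))⁻¹ * (1 + α / (β - α)), by positivity, ?_⟩
  intro cS L_G ρ T Φ G u hcS hL hρ _ _ hΦ hΦdiff hΦsmooth hG0 hG hGprj _ hfin s r t hs hsr hrt htT
  obtain ⟨N₁, N₂, hN₁, hN₂, hN, hu, hδ⟩ := hfin.exists_bounds
  have hc : 0 ≤ cS := by linarith
  have hrs : 0 < r - s := sub_pos.2 hsr
  have htr : 0 < t - r := sub_pos.2 hrt
  have hGu : ∀ q, 0 ≤ q → q ≤ r → ‖G (u q)‖ ≤ L_G * (N₁ * Real.exp (ρ * r)) := fun q h0 hq =>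
    calc ‖G (u q)‖ ≤ L_G * ‖u q‖ := by simpa [hG0] using hG (u q) 0
      _ ≤ L_G * (N₁ * Real.exp (ρ * q)) := by
          gcongr
          exact hu q h0 (by linarith)
      _ ≤ L_G * (N₁ * Real.exp (ρ * r)) := by gcongr
  have hval : ‖Φ (t - r) (G (u r))‖ ≤ cS * L_G * (N₁ + N₂) * Real.exp (ρ * r) :=
    calc ‖Φ (t - r) (G (u r))‖ ≤ cS * (L_G * ((N₁ + N₂) * Real.exp (ρ * r))) := by
          refine (hΦ _ htr _).trans ?_
          gcongr
          refine (hGu r (by linarith) le_rfl).trans ?_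
          gcongr
          linarith
      _ = _ := by ring
  have hincr : ∀ q, s < q → q < r → ‖Φ (t - r) (G (u r)) - Φ (t - q) (G (u q))‖ ≤
      cS * L_G * (N₁ + N₂) * Real.exp (ρ * r) * (t - r) ^ (-β) * (r - q) ^ β := by
    intro q hsq hqr
    have hq : 0 < r - q := sub_pos.2 hqr
    have hspace : ‖Φ (t - r) (G (u r) - G (u q))‖ ≤
        cS * (t - r) ^ (-β) * (L_G * (N₂ * (r - q) ^ β * Real.exp (ρ * r))) := by
      refine (hΦsmooth _ htr _).trans ?_
      gcongr
      refine (hGprj _ _).trans ?_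
      gcongr
      exact hδ q r (by linarith) hqr (by linarith)
    have htime : ‖Φ (t - r) (G (u q)) - Φ (t - q) (G (u q))‖ ≤
        cS * (r - q) ^ β * (t - r) ^ (-β) * (L_G * (N₁ * Real.exp (ρ * r))) := by
      have h := hΦdiff (t - r) (t - q) htr (by linarith) (G (u q))
      rw [show t - q - (t - r) = r - q by ring] at h
      refine h.trans ?_
      gcongr
      exact hGu q (by linarith) hqr.le
    calc _ = ‖Φ (t - r) (G (u r) - G (u q)) +
          (Φ (t - r) (G (u q)) - Φ (t - q) (G (u q)))‖ := by
          rw [map_sub, sub_add_sub_cancel]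
      _ ≤ _ := (norm_add_le _ _).trans (add_le_add hspace htime)
      _ = _ := by ring
  refine (norm_weylD_le_of_holder h0α hαβ (hαβ.trans hβ1) hsr hval hincr).trans ?_
  rw [hN]
  set M := cS * L_G * (N₁ + N₂) * Real.exp (ρ * r) with hM
  have hM0 : 0 ≤ M := by positivity
  set X := (r - s) ^ (-α)
  have hX : 0 ≤ X := by positivity
  set Y := (t - r) ^ (-β) * (r - s) ^ (β - α) with hY
  have hY0 : 0 ≤ Y := by positivity
  calc _ = (Real.Gamma (1 - α))⁻¹ * (M * X + α / (β - α) * (M * Y)) := by rw [hY]; ring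
    _ ≤ (Real.Gamma (1 - α))⁻¹ * ((1 + α / (β - α)) * (M * (X + Y))) := by
        gcongr
        have h₁ : 0 ≤ M * Y := by positivity
        have h₂ : 0 ≤ α / (β - α) * (M * X) := by positivity
        linarith
    _ = _ := by rw [hM]; ring
end

section
/- Let f : E → E satisfy ‖f(x) − f(y)‖ ≤ L_F ‖x − y‖ for all x, y ∈ E, where L_F ≥ 0. Let u, v : [0,T] → E be continuous with ‖u‖_{β,ρ,−β} < ∞ and ‖v‖_{β,ρ,−β} < ∞. Then ‖ t ↦ ∫_0^t S_{t−r}(f(u(r)) − f(v(r))) dr ‖_{β,ρ,−β} ≤ c_S · L_F · ( 2 K₂(ρ) + K₂(ρ)^{1−β} ) · ‖u − v‖_{β,ρ,−β}. In particular, since K₂(ρ) → 0 as ρ → ∞, the prefactor can be made arbitrarily small by choosing ρ large. -/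
open Set Filter Topology MeasureTheory

/-- If a uniformly bounded family of operators is strongly continuous, then it may be applied
along a continuous path, here in convolution form. -/
lemma continuousOn_convolution_integrand {E : Type*} [NormedAddCommGroup E] [NormedSpace ℝ E]
    {c T t : ℝ} {S : ℝ → E →L[ℝ] E}
    (hScont : ∀ x : E, ContinuousOn (fun τ => S τ x) (Icc 0 T))
    (hSbdd : ∀ τ ∈ Icc (0 : ℝ) T, ∀ x : E, ‖S τ x‖ ≤ c * ‖x‖)
    {g : ℝ → E} (hg : ContinuousOn g (Icc 0 T)) (htT : t ≤ T) :
    ContinuousOn (fun r => S (t - r) (g r)) (Icc 0 t) := by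
  have hmaps : MapsTo (fun r => t - r) (Icc 0 t) (Icc 0 T) := fun r hr =>
    ⟨by linarith [hr.2], by linarith [hr.1]⟩
  intro r₀ hr₀
  have h1 : Tendsto (fun r => S (t - r) (g r₀)) (𝓝[Icc 0 t] r₀) (𝓝 (S (t - r₀) (g r₀))) :=
    ((hScont (g r₀)).comp (by fun_prop) hmaps) r₀ hr₀
  have hg0 : Tendsto (fun r => c * ‖g r - g r₀‖) (𝓝[Icc 0 t] r₀) (𝓝 0) := by
    have hgr : Tendsto g (𝓝[Icc 0 t] r₀) (𝓝 (g r₀)) :=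
      hg.mono (Icc_subset_Icc_right htT) r₀ hr₀
    simpa using ((tendsto_iff_norm_sub_tendsto_zero.1 hgr).const_mul c)
  have h2 : Tendsto (fun r => S (t - r) (g r - g r₀)) (𝓝[Icc 0 t] r₀) (𝓝 0) := by
    refine squeeze_zero_norm' ?_ hg0
    filter_upwards [self_mem_nhdsWithin] with r hr
    exact hSbdd _ (hmaps hr) _
  simpa [ContinuousWithinAt] using h2.add h1

lemma norm_integral_le_of_norm_le_exp {G : Type*} [NormedAddCommGroup G] [NormedSpace ℝ G]
    {a b C ρ : ℝ} (hab : a ≤ b) (hρ : 0 < ρ) {h : ℝ → G}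
    (hh : ∀ r ∈ Icc a b, ‖h r‖ ≤ C * Real.exp (ρ * r)) :
    ‖∫ r in a..b, h r‖ ≤ C * ((Real.exp (ρ * b) - Real.exp (ρ * a)) / ρ) := by
  have hint : ∫ r in a..b, C * Real.exp (ρ * r) =
      C * ((Real.exp (ρ * b) - Real.exp (ρ * a)) / ρ) := by
    rw [intervalIntegral.integral_const_mul,
      intervalIntegral.integral_comp_mul_left (fun x => Real.exp x) hρ.ne', integral_exp,
      smul_eq_mul]
    ring
  rw [← hint]
  refine intervalIntegral.norm_integral_le_of_norm_le hab
    (ae_of_all _ fun r hr => hh r (Ioc_subset_Icc_self hr)) ?_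
  exact (by fun_prop : Continuous fun r => C * Real.exp (ρ * r)).intervalIntegrable _ _

lemma le_rpow_one_sub_mul_rpow {x K h β : ℝ} (hx : 0 ≤ x) (hxK : x ≤ K) (hxh : x ≤ h)
    (hβ0 : 0 ≤ β) (hβ1 : β ≤ 1) : x ≤ K ^ (1 - β) * h ^ β :=
  calc x = x ^ (1 - β) * x ^ β := by
        rw [← Real.rpow_add' hx (by norm_num), sub_add_cancel, Real.rpow_one]
    _ ≤ K ^ (1 - β) * h ^ β :=
        mul_le_mul (Real.rpow_le_rpow hx hxK (sub_nonneg.2 hβ1)) (Real.rpow_le_rpow hx hxh hβ0)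
          (Real.rpow_nonneg hx _) (Real.rpow_nonneg (hx.trans hxK) _)

lemma exp_mul_exp_sub_div_le {ρ T t a b : ℝ} (hρ : 0 < ρ) (hab : b ≤ t) (hta : t - a ≤ T) :
    Real.exp (-(ρ * t)) * ((Real.exp (ρ * b) - Real.exp (ρ * a)) / ρ) ≤
      (1 - Real.exp (-(ρ * T))) / ρ := by
  rw [← mul_div_assoc, mul_sub, ← Real.exp_add, ← Real.exp_add]
  gcongr
  · rw [Real.exp_le_one_iff]
    nlinarith
  · nlinarith

lemma exp_mul_exp_sub_div_le_sub {ρ s t : ℝ} (hρ : 0 < ρ) :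
    Real.exp (-(ρ * t)) * ((Real.exp (ρ * t) - Real.exp (ρ * s)) / ρ) ≤ t - s := by
  rw [← mul_div_assoc, mul_sub, ← Real.exp_add, ← Real.exp_add, div_le_iff₀ hρ,
    neg_add_cancel, Real.exp_zero]
  linarith [Real.add_one_le_exp (-(ρ * t) + ρ * s)]

lemma hFin_and_hNorm_le_of_bounds {E F : Type*} [NormedAddCommGroup E] [NormedSpace ℝ E]
    [NormedAddCommGroup F] [NormedSpace ℝ F] {ι : E →L[ℝ] F} {β ρ T A B : ℝ} {w : ℝ → E}
    (hT : 0 < T) (hA : ∀ t ∈ Icc 0 T, Real.exp (-(ρ * t)) * ‖w t‖ ≤ A)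
    (hB : ∀ s t, 0 ≤ s → s < t → t ≤ T →
      Real.exp (-(ρ * t)) * ‖ι (w t) - ι (w s)‖ ≤ B * (t - s) ^ β) :
    hFin ι β ρ T w ∧ hNorm ι β ρ T w ≤ A + B := by
  have hA' : ∀ y ∈ (fun t => Real.exp (-(ρ * t)) * ‖w t‖) '' Icc 0 T, y ≤ A := by
    rintro _ ⟨t, ht, rfl⟩
    exact hA t ht
  have hB' : ∀ y ∈ (fun p : ℝ × ℝ =>
      Real.exp (-(ρ * p.2)) * ‖ι (w p.2) - ι (w p.1)‖ / (p.2 - p.1) ^ β) ''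
      {p : ℝ × ℝ | 0 ≤ p.1 ∧ p.1 < p.2 ∧ p.2 ≤ T}, y ≤ B := by
    rintro _ ⟨⟨s, t⟩, ⟨hs, hst, ht⟩, rfl⟩
    exact (div_le_iff₀ (Real.rpow_pos_of_pos (sub_pos.2 hst) β)).2 (hB s t hs hst ht)
  refine ⟨⟨⟨A, hA'⟩, ⟨B, hB'⟩⟩, add_le_add (csSup_le ?_ hA') (csSup_le ?_ hB')⟩
  · exact (nonempty_Icc.2 hT.le).image _
  · exact Set.Nonempty.image _ ⟨(0, T), le_rfl, hT, le_rfl⟩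

lemma exp_mul_norm_le_hNorm {E F : Type*} [NormedAddCommGroup E] [NormedSpace ℝ E]
    [NormedAddCommGroup F] [NormedSpace ℝ F] (ι : E →L[ℝ] F) (β ρ : ℝ) {T : ℝ} {w : ℝ → E}
    (hw : ContinuousOn w (Icc 0 T)) {t : ℝ} (ht : t ∈ Icc 0 T) :
    Real.exp (-(ρ * t)) * ‖w t‖ ≤ hNorm ι β ρ T w := by
  have hbdd : BddAbove ((fun t => Real.exp (-(ρ * t)) * ‖w t‖) '' Icc 0 T) :=
    isCompact_Icc.bddAbove_image (by fun_prop)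
  refine (le_csSup hbdd (mem_image_of_mem _ ht)).trans (le_add_of_nonneg_right ?_)
  refine Real.sSup_nonneg ?_
  rintro _ ⟨⟨s, t⟩, ⟨-, hst, -⟩, rfl⟩
  have := Real.rpow_nonneg (sub_nonneg.2 hst.le) β
  positivity

/-- The difference of drift convolutions satisfies
`‖∫_0^· S(·−r)(f(u(r))−f(v(r))) dr‖_{β,ρ,−β}
  ≤ c_S L_F (2 K₂(ρ) + K₂(ρ)^{1−β}) ‖u−v‖_{β,ρ,−β}` where `K₂(ρ) = (1 − e^{−ρT})/ρ`;
in particular the difference of convolutions has finite norm. -/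
theorem drift_convolution_difference_bound
    {E F : Type*}
    [NormedAddCommGroup E] [NormedSpace ℝ E] [CompleteSpace E]
    [NormedAddCommGroup F] [NormedSpace ℝ F] [CompleteSpace F]
    (ι : E →L[ℝ] F) (hι : ∀ x : E, ‖ι x‖ ≤ ‖x‖)
    (β cS T ρ : ℝ) (h0β : 0 < β) (hβ1 : β < 1) (hcS : 1 ≤ cS) (hT : 0 < T) (hρ : 0 < ρ)
    (S : ℝ → E →L[ℝ] E)
    (hScont : ∀ x : E, ContinuousOn (fun τ => S τ x) (Set.Icc 0 T))
    (hSbdd : ∀ τ ∈ Set.Icc (0 : ℝ) T, ∀ x : E, ‖S τ x‖ ≤ cS * ‖x‖)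
    (hShold : ∀ a b : ℝ, 0 ≤ a → a ≤ b → b ≤ T → ∀ x : E,
      ‖ι (S b x) - ι (S a x)‖ ≤ cS * (b - a) ^ β * ‖x‖)
    (L_F : ℝ) (hLF : 0 ≤ L_F)
    (f : E → E)
    (hfLip : ∀ x y : E, ‖f x - f y‖ ≤ L_F * ‖x - y‖)
    (u v : ℝ → E)
    (hu : ContinuousOn u (Set.Icc 0 T)) (hv : ContinuousOn v (Set.Icc 0 T))
    (hufin : hFin ι β ρ T u) (hvfin : hFin ι β ρ T v) :
    hFin ι β ρ T (fun t => ∫ r in (0 : ℝ)..t, S (t - r) (f (u r) - f (v r))) ∧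
      hNorm ι β ρ T (fun t => ∫ r in (0 : ℝ)..t, S (t - r) (f (u r) - f (v r))) ≤
        cS * L_F *
            (2 * ((1 - Real.exp (-(ρ * T))) / ρ) +
              ((1 - Real.exp (-(ρ * T))) / ρ) ^ (1 - β)) *
          hNorm ι β ρ T (fun x => u x - v x) := by
  have hfc : Continuous f := (LipschitzWith.of_dist_le' (K := L_F) fun x y => by
    simpa [dist_eq_norm] using hfLip x y).continuous
  set w : ℝ → E := fun x => u x - v x
  set N := hNorm ι β ρ T w
  set K := (1 - Real.exp (-(ρ * T))) / ρ
  set g : ℝ → E := fun r => f (u r) - f (v r)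
  have hw : ContinuousOn w (Icc 0 T) := hu.sub hv
  have hg : ContinuousOn g (Icc 0 T) := (hfc.comp_continuousOn hu).sub (hfc.comp_continuousOn hv)
  have hcS0 : 0 ≤ cS := zero_le_one.trans hcS
  have hN0 : 0 ≤ N := le_trans (by positivity)
    (exp_mul_norm_le_hNorm ι β ρ hw (left_mem_Icc.2 hT.le))
  have hgN : ∀ r ∈ Icc 0 T, ‖g r‖ ≤ L_F * N * Real.exp (ρ * r) := by
    intro r hr
    have h1 : ‖w r‖ ≤ N * Real.exp (ρ * r) := by
      have h2 := exp_mul_norm_le_hNorm ι β ρ hw hr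
      rwa [Real.exp_neg, inv_mul_le_iff₀ (Real.exp_pos _), mul_comm] at h2
    calc ‖g r‖ ≤ L_F * ‖w r‖ := hfLip _ _
      _ ≤ L_F * (N * Real.exp (ρ * r)) := by gcongr
      _ = _ := by ring
  have hSg : ∀ t ≤ T, ∀ r ∈ Icc 0 t,
      ‖S (t - r) (g r)‖ ≤ cS * (L_F * N) * Real.exp (ρ * r) := by
    intro t ht r hr
    calc ‖S (t - r) (g r)‖ ≤ cS * ‖g r‖ :=
          hSbdd _ ⟨by linarith [hr.2], by linarith [hr.1]⟩ _
      _ ≤ cS * (L_F * N * Real.exp (ρ * r)) := by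
          gcongr
          exact hgN r ⟨hr.1, hr.2.trans ht⟩
      _ = _ := by ring
  have hcont : ∀ t ≤ T, ContinuousOn (fun r => S (t - r) (g r)) (Icc 0 t) := fun t ht =>
    continuousOn_convolution_integrand hScont hSbdd hg ht
  have hint : ∀ t ≤ T, ∀ a b, 0 ≤ a → a ≤ b → b ≤ t →
      IntervalIntegrable (fun r => S (t - r) (g r)) volume a b := fun t ht a b ha hab hb =>
    ((hcont t ht).mono (Icc_subset_Icc ha hb)).intervalIntegrable_of_Icc hab
  have hsup : ∀ t ∈ Icc 0 T,
      Real.exp (-(ρ * t)) * ‖∫ r in (0 : ℝ)..t, S (t - r) (g r)‖ ≤ cS * (L_F * N) * K := by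
    intro t ht
    calc Real.exp (-(ρ * t)) * ‖∫ r in (0 : ℝ)..t, S (t - r) (g r)‖
        ≤ Real.exp (-(ρ * t)) * (cS * (L_F * N) *
            ((Real.exp (ρ * t) - Real.exp (ρ * 0)) / ρ)) := by
          gcongr
          exact norm_integral_le_of_norm_le_exp ht.1 hρ (hSg t ht.2)
      _ = cS * (L_F * N) * (Real.exp (-(ρ * t)) *
            ((Real.exp (ρ * t) - Real.exp (ρ * 0)) / ρ)) := by ring
      _ ≤ cS * (L_F * N) * K := by
          gcongr
          exact exp_mul_exp_sub_div_le hρ le_rfl (by linarith [ht.2])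
  have hhold : ∀ s t, 0 ≤ s → s < t → t ≤ T →
      Real.exp (-(ρ * t)) * ‖ι (∫ r in (0 : ℝ)..t, S (t - r) (g r)) -
        ι (∫ r in (0 : ℝ)..s, S (s - r) (g r))‖ ≤
      cS * (L_F * N) * (K + K ^ (1 - β)) * (t - s) ^ β := by
    intro s t hs hst ht
    have hsT : s ≤ T := hst.le.trans ht
    have hts : 0 ≤ (t - s) ^ β := Real.rpow_nonneg (sub_nonneg.2 hst.le) β
    have hdecomp : ι (∫ r in (0 : ℝ)..t, S (t - r) (g r)) -
        ι (∫ r in (0 : ℝ)..s, S (s - r) (g r)) =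
        (∫ r in (0 : ℝ)..s, (ι (S (t - r) (g r)) - ι (S (s - r) (g r)))) +
          ι (∫ r in s..t, S (t - r) (g r)) := by
      have h1 := hint t ht 0 s le_rfl hs hst.le
      have h2 := hint s hsT 0 s le_rfl hs le_rfl
      rw [← intervalIntegral.integral_add_adjacent_intervals h1 (hint t ht s t hs hst.le le_rfl),
        map_add, add_sub_right_comm, ← map_sub, ← intervalIntegral.integral_sub h1 h2,
        ← ι.intervalIntegral_comp_comm (h1.sub h2)]
      simp only [map_sub]
    have hpast : ‖∫ r in (0 : ℝ)..s, (ι (S (t - r) (g r)) - ι (S (s - r) (g r)))‖ ≤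
        cS * (t - s) ^ β * (L_F * N) * ((Real.exp (ρ * s) - Real.exp (ρ * 0)) / ρ) := by
      refine norm_integral_le_of_norm_le_exp hs hρ fun r hr => ?_
      have h1 := hShold (s - r) (t - r) (by linarith [hr.2]) (by linarith)
        (by linarith [hr.1]) (g r)
      rw [sub_sub_sub_cancel_right] at h1
      calc _ ≤ cS * (t - s) ^ β * ‖g r‖ := h1
        _ ≤ cS * (t - s) ^ β * (L_F * N * Real.exp (ρ * r)) := by
            gcongr
            exact hgN r ⟨hr.1, hr.2.trans hsT⟩
        _ = _ := by ring
    have hrecent : ‖ι (∫ r in s..t, S (t - r) (g r))‖ ≤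
        cS * (L_F * N) * ((Real.exp (ρ * t) - Real.exp (ρ * s)) / ρ) :=
      (hι _).trans <| norm_integral_le_of_norm_le_exp hst.le hρ fun r hr =>
        hSg t ht r ⟨hs.trans hr.1, hr.2⟩
    have hK1 : Real.exp (-(ρ * t)) * ((Real.exp (ρ * s) - Real.exp (ρ * 0)) / ρ) ≤ K :=
      exp_mul_exp_sub_div_le hρ hst.le (by linarith)
    have hK2 : Real.exp (-(ρ * t)) * ((Real.exp (ρ * t) - Real.exp (ρ * s)) / ρ) ≤
        K ^ (1 - β) * (t - s) ^ β := by
      refine le_rpow_one_sub_mul_rpow ?_ (exp_mul_exp_sub_div_le hρ le_rfl (by linarith))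
        (exp_mul_exp_sub_div_le_sub hρ) h0β.le hβ1.le
      have : Real.exp (ρ * s) ≤ Real.exp (ρ * t) := by gcongr
      have := sub_nonneg.2 this
      positivity
    rw [hdecomp]
    calc _ ≤ Real.exp (-(ρ * t)) *
          (cS * (t - s) ^ β * (L_F * N) * ((Real.exp (ρ * s) - Real.exp (ρ * 0)) / ρ) +
            cS * (L_F * N) * ((Real.exp (ρ * t) - Real.exp (ρ * s)) / ρ)) := by
          gcongr
          exact (norm_add_le _ _).trans (add_le_add hpast hrecent)
      _ = cS * (L_F * N) * (t - s) ^ β *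
            (Real.exp (-(ρ * t)) * ((Real.exp (ρ * s) - Real.exp (ρ * 0)) / ρ)) +
          cS * (L_F * N) *
            (Real.exp (-(ρ * t)) * ((Real.exp (ρ * t) - Real.exp (ρ * s)) / ρ)) := by ring
      _ ≤ cS * (L_F * N) * (t - s) ^ β * K +
          cS * (L_F * N) * (K ^ (1 - β) * (t - s) ^ β) := by gcongr
      _ = _ := by ring
  obtain ⟨hfin, hle⟩ := hFin_and_hNorm_le_of_bounds (ι := ι) hT hsup hhold
  exact ⟨hfin, hle.trans_eq (by ring)⟩
end

section
/- Let Ω be a nonempty set, θ : Ω → Ω a map, L > 0, κ > 0, and let r̂ : Ω → ℝ be strictly positive. Define ρ̂ : Ω → ℝ by ρ̂(ω) := (1/L) · inf_{i∈ℕ} e^{κ i} r̂(θ^i ω), where θ^i denotes the i-th iterate of θ. Then: (a) for every ω ∈ Ω and every i ∈ ℕ, ρ̂(ω) ≥ 0 and L e^{−κ i} ρ̂(ω) ≤ r̂(θ^i ω); (b) if ω ∈ Ω is such that for every ε > 0 there exists N ∈ ℕ with L e^{−ε k} ≤ r̂(θ^k ω) ≤ L for all k ≥ N, then for every ε with 0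 < ε < κ there exists N ∈ ℕ such that e^{−ε i} ≤ ρ̂(θ^i ω) ≤ 1 for all i ≥ N (so ρ̂ is tempered from below along the orbit of ω). -/
/-- `ρ̂(ω) = (1/L) · inf_{i∈ℕ} e^{κ i} r̂(θ^i ω)`. -/
noncomputable def rhoHat {Ω : Type*} (θ : Ω → Ω) (L κ : ℝ) (rHat : Ω → ℝ) (ω : Ω) : ℝ :=
  (1 / L) * sInf (Set.range fun i : ℕ => Real.exp (κ * i) * rHat (θ^[i] ω))

section rhoHat

variable {Ω : Type*} {θ : Ω → Ω} {L κ : ℝ} {rHat : Ω → ℝ}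

theorem rhoHat_nonneg (hL : 0 ≤ L) (hr : ∀ ω, 0 ≤ rHat ω) (ω : Ω) :
    0 ≤ rhoHat θ L κ rHat ω := by
  refine mul_nonneg (by positivity) (Real.sInf_nonneg ?_)
  rintro _ ⟨i, rfl⟩
  exact mul_nonneg (Real.exp_pos _).le (hr _)

theorem mul_rhoHat_le (hL : 0 < L) (hr : ∀ ω, 0 ≤ rHat ω) (ω : Ω) (i : ℕ) :
    L * rhoHat θ L κ rHat ω ≤ Real.exp (κ * i) * rHat (θ^[i] ω) := by
  rw [rhoHat, ← mul_assoc, mul_one_div_cancel hL.ne', one_mul]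
  refine csInf_le ⟨0, ?_⟩ ⟨i, rfl⟩
  rintro _ ⟨j, rfl⟩
  exact mul_nonneg (Real.exp_pos _).le (hr _)

theorem le_rhoHat (hL : 0 < L) {ω : Ω} {c : ℝ}
    (h : ∀ i : ℕ, L * c ≤ Real.exp (κ * i) * rHat (θ^[i] ω)) :
    c ≤ rhoHat θ L κ rHat ω := by
  rw [rhoHat, one_div, ← div_eq_inv_mul, le_div_iff₀' hL]
  refine le_csInf (Set.range_nonempty _) ?_
  rintro _ ⟨i, rfl⟩
  exact h i

end rhoHat

/-- For a strictly positive `r̂` and `ρ̂(ω) = (1/L) inf_i e^{κ i} r̂(θ^i ω)`: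
(a) `ρ̂ ≥ 0` and `L e^{−κ i} ρ̂(ω) ≤ r̂(θ^i ω)` for all `i`;
(b) if along the orbit of `ω`, for every `ε > 0` eventually `L e^{−ε k} ≤ r̂(θ^k ω) ≤ L`,
then for every `0 < ε < κ` eventually `e^{−ε i} ≤ ρ̂(θ^i ω) ≤ 1`,
i.e. `ρ̂` is tempered from below along the orbit of `ω`. -/
theorem rhoHat_tempered
    {Ω : Type*} [Nonempty Ω] (θ : Ω → Ω) (L κ : ℝ) (hL : 0 < L) (hκ : 0 < κ)
    (rHat : Ω → ℝ) (hr : ∀ ω, 0 < rHat ω) :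
    (∀ ω : Ω, 0 ≤ rhoHat θ L κ rHat ω ∧
      ∀ i : ℕ, L * Real.exp (-(κ * i)) * rhoHat θ L κ rHat ω ≤ rHat (θ^[i] ω)) ∧
    (∀ ω : Ω,
      (∀ ε > (0 : ℝ), ∃ N : ℕ, ∀ k ≥ N,
        L * Real.exp (-(ε * k)) ≤ rHat (θ^[k] ω) ∧ rHat (θ^[k] ω) ≤ L) →
      ∀ ε : ℝ, 0 < ε → ε < κ → ∃ N : ℕ, ∀ i ≥ N,
        Real.exp (-(ε * i)) ≤ rhoHat θ L κ rHat (θ^[i] ω) ∧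
          rhoHat θ L κ rHat (θ^[i] ω) ≤ 1) := by
  have hr' : ∀ ω, 0 ≤ rHat ω := fun ω => (hr ω).le
  refine ⟨fun ω => ⟨rhoHat_nonneg hL.le hr' ω, fun i => ?_⟩, fun ω h ε hε hεκ => ?_⟩
  · calc L * Real.exp (-(κ * i)) * rhoHat θ L κ rHat ω
        = Real.exp (-(κ * i)) * (L * rhoHat θ L κ rHat ω) := by ring
      _ ≤ Real.exp (-(κ * i)) * (Real.exp (κ * i) * rHat (θ^[i] ω)) :=
        mul_le_mul_of_nonneg_left (mul_rhoHat_le hL hr' ω i) (Real.exp_pos _).le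
      _ = rHat (θ^[i] ω) := by
        rw [← mul_assoc, ← Real.exp_add, neg_add_cancel, Real.exp_zero, one_mul]
  · obtain ⟨N, hN⟩ := h ε hε
    refine ⟨N, fun i hi => ⟨le_rhoHat hL fun j => ?_, ?_⟩⟩
    · calc L * Real.exp (-(ε * i))
          ≤ L * Real.exp (κ * j + -(ε * (j + i : ℕ))) := by
            gcongr
            push_cast
            nlinarith [mul_nonneg (sub_nonneg.2 hεκ.le) (Nat.cast_nonneg (α := ℝ) j)]
        _ = Real.exp (κ * j) * (L * Real.exp (-(ε * (j + i : ℕ)))) := by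
            rw [Real.exp_add]
            ring
        _ ≤ Real.exp (κ * j) * rHat (θ^[j] (θ^[i] ω)) := by
            rw [← Function.iterate_add_apply]
            gcongr
            exact (hN (j + i) (by omega)).1
    · have h0 := mul_rhoHat_le (θ := θ) (κ := κ) hL hr' (θ^[i] ω) 0
      simp only [Nat.cast_zero, mul_zero, Real.exp_zero, one_mul, Function.iterate_zero, id] at h0
      exact le_of_mul_le_mul_left (by linarith [(hN i hi).2]) hL
end

section
/- Let Ω be a nonempty set and θ : ℝ → Ω → Ω a flow satisfying θ_{a+b} = θ_a ∘ θ_b for all a, b ∈ ℝ. Let r̂ : Ω → ℝ be nonnegative, and let L > 0 and κ > 0. Define r̄(ω) := inf_{s∈[0,1]} r̂(θ_s ω), ρ̂(ω) := (1/L) · inf_{i∈ℕ} e^{κ i} r̂(θ_i ω), and ρ̄(ω) := (1/L) · inf_{i∈ℕ} e^{κ i} r̄(θ_i ω), where θ_i denotes the flow at integer time i. Then for every ω ∈ Ω and every s ∈ [0,1], ρ̄(ω) ≤ ρ̂(θ_s ω). -/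
/-- For a flow `θ` on `Ω`, a nonnegative `r̂ : Ω → ℝ`,
`r̄(ω) = inf_{s∈[0,1]} r̂(θ_s ω)`, `ρ̂(ω) = (1/L) inf_{i∈ℕ} e^{κ i} r̂(θ_i ω)` and
`ρ̄(ω) = (1/L) inf_{i∈ℕ} e^{κ i} r̄(θ_i ω)`, one has `ρ̄(ω) ≤ ρ̂(θ_s ω)` for every
`ω ∈ Ω` and `s ∈ [0,1]`. -/
theorem rhoBar_le_rhoHat
    {Ω : Type*} [Nonempty Ω] (θ : ℝ → Ω → Ω)
    (hflow : ∀ a b : ℝ, ∀ ω : Ω, θ (a + b) ω = θ a (θ b ω))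
    (rHat : Ω → ℝ) (hr : ∀ ω, 0 ≤ rHat ω)
    (L κ : ℝ) (hL : 0 < L) (hκ : 0 < κ) :
    ∀ ω : Ω, ∀ s ∈ Set.Icc (0 : ℝ) 1,
      (1 / L) * sInf (Set.range fun i : ℕ =>
          Real.exp (κ * i) * sInf ((fun σ => rHat (θ σ (θ (i : ℝ) ω))) '' Set.Icc 0 1)) ≤
        (1 / L) * sInf (Set.range fun i : ℕ =>
          Real.exp (κ * i) * rHat (θ (i : ℝ) (θ s ω))) := by
  intro ω s hs
  refine mul_le_mul_of_nonneg_left ?_ (by positivity)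
  refine le_csInf (Set.range_nonempty _) ?_
  rintro _ ⟨i, rfl⟩
  have hcomm : θ (i : ℝ) (θ s ω) = θ s (θ (i : ℝ) ω) := by
    rw [← hflow, add_comm, hflow]
  have hbdd : BddBelow (Set.range fun j : ℕ =>
      Real.exp (κ * j) * sInf ((fun σ => rHat (θ σ (θ (j : ℝ) ω))) '' Set.Icc 0 1)) := by
    refine ⟨0, ?_⟩
    rintro _ ⟨j, rfl⟩
    refine mul_nonneg (Real.exp_pos _).le (Real.sInf_nonneg ?_)
    rintro _ ⟨σ, -, rfl⟩
    exact hr _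
  refine (csInf_le hbdd ⟨i, rfl⟩).trans ?_
  refine mul_le_mul_of_nonneg_left ?_ (Real.exp_pos _).le
  rw [hcomm]
  refine csInf_le ⟨0, ?_⟩ ⟨s, hs, rfl⟩
  rintro _ ⟨σ, -, rfl⟩
  exact hr _
end
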